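/- (Case II, Subcase II of Theorem 1.) Let x₁, x₂ : Fin d → ℝ≥0 each have at least one nonempty K-sample among the n samples, and let i be an index such that both θ_i(x₁) and θ_i(x₂) are empty. If the cyclic distances to the nearest nonempty samples differ, r₁(i) ≠ r₂(i), then H_Dwta(x₁,i) ≠ H_Dwta(x₂,i); more precisely, if r₁(i) > r₂(i) then H_Dwta(x₁,i) > H_Dwta(x₂,i). -/

import Mathlib

open scoped NNReal

/-- The `K`-sample of `x` under permutation `θ`: the tuple `(x (θ 0), …, x (θ (K-1)))`. -/
noncomputable def sample {d K : ℕ} (hK : K ≤ d) (θ : Equiv.Perm (Fin d))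
    (x : Fin d → ℝ≥0) : Fin K → ℝ≥0 :=
  fun j => x (θ (Fin.castLE hK j))

/-- A sample is empty if all of its entries are `0`. -/
def isEmptyS {K : ℕ} (s : Fin K → ℝ≥0) : Prop := ∀ j, s j = 0

/-- The WTA hash of a sample: the least index attaining the maximum entry. -/
noncomputable def hwta {K : ℕ} (s : Fin K → ℝ≥0) : ℕ :=
  sInf {j : ℕ | ∃ h : j < K, ∀ m : Fin K, s m ≤ s ⟨j, h⟩}

/-- The cyclic distance from index `i` to the nearest index (towards the right)
whose sample is nonempty. -/
noncomputable def rdist {d K n : ℕ} (hK : K ≤ d) (θs : Fin n → Equiv.Perm (Fin d))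
    (x : Fin d → ℝ≥0) (i : Fin n) : ℕ :=
  sInf {r : ℕ | ¬ isEmptyS (sample hK (θs ⟨(i.val + r) % n, Nat.mod_lt _ i.pos⟩) x)}

/-- The densified WTA hash: `H_Dwta(x,i) = H_wta(θ_{(i+r(i)) mod n}(x)) + C·r(i)`. -/
noncomputable def hDwta {d K n : ℕ} (hK : K ≤ d) (θs : Fin n → Equiv.Perm (Fin d))
    (C : ℕ) (x : Fin d → ℝ≥0) (i : Fin n) : ℕ :=
  hwta (sample hK (θs ⟨(i.val + rdist hK θs x i) % n, Nat.mod_lt _ i.pos⟩) x)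
    + C * rdist hK θs x i

theorem hwta_lt_aux {K : ℕ} (hK1 : 1 ≤ K) (s : Fin K → ℝ≥0) : hwta s < K := by
  haveI : Nonempty (Fin K) := ⟨⟨0, hK1⟩⟩
  obtain ⟨j, hj⟩ := Finite.exists_max s
  have hne : {j : ℕ | ∃ h : j < K, ∀ m : Fin K, s m ≤ s ⟨j, h⟩}.Nonempty :=
    ⟨j.val, j.isLt, hj⟩
  obtain ⟨h, _⟩ := Nat.sInf_mem hne
  exact h

theorem hDwta_lt_aux {d K n : ℕ} (hK1 : 1 ≤ K) (hKd : K ≤ d)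
    (θs : Fin n → Equiv.Perm (Fin d)) (C : ℕ) (hC : K < C)
    (x y : Fin d → ℝ≥0) (i : Fin n) (h : rdist hKd θs x i < rdist hKd θs y i) :
    hDwta hKd θs C x i < hDwta hKd θs C y i := by
  unfold hDwta
  have h1 := hwta_lt_aux hK1
    (sample hKd (θs ⟨(i.val + rdist hKd θs x i) % n, Nat.mod_lt _ i.pos⟩) x)
  have h2 : C * (rdist hKd θs x i + 1) ≤ C * rdist hKd θs y i := Nat.mul_le_mul_left C h
  rw [Nat.mul_add, Nat.mul_one] at h2
  omega

/-- Case II, Subcase II of Theorem 1: if both samples at index `i` are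
empty and the cyclic distances to the nearest nonempty samples differ, then the densified
hashes do not collide; more precisely, `r₁(i) > r₂(i)` implies
`H_Dwta(x₁,i) > H_Dwta(x₂,i)`. -/
theorem densified_no_collision_of_both_empty_ne_rdist
    {d K n : ℕ} (hK1 : 1 ≤ K) (hKd : K ≤ d)
    (θs : Fin n → Equiv.Perm (Fin d)) (C : ℕ) (hC : K < C)
    (x₁ x₂ : Fin d → ℝ≥0)
    (hx₁ : ∃ i : Fin n, ¬ isEmptyS (sample hKd (θs i) x₁))
    (hx₂ : ∃ i : Fin n, ¬ isEmptyS (sample hKd (θs i) x₂))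
    (i : Fin n)
    (h₁ : isEmptyS (sample hKd (θs i) x₁))
    (h₂ : isEmptyS (sample hKd (θs i) x₂)) :
    (rdist hKd θs x₁ i ≠ rdist hKd θs x₂ i →
      hDwta hKd θs C x₁ i ≠ hDwta hKd θs C x₂ i) ∧
    (rdist hKd θs x₂ i < rdist hKd θs x₁ i →
      hDwta hKd θs C x₂ i < hDwta hKd θs C x₁ i) := by
  refine ⟨fun h => ?_, hDwta_lt_aux hK1 hKd θs C hC x₂ x₁ i⟩
  rcases lt_or_gt_of_ne h with h | h
  · exact (hDwta_lt_aux hK1 hKd θs C hC x₁ x₂ i h).ne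
  · exact (hDwta_lt_aux hK1 hKd θs C hC x₂ x₁ i h).ne'
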